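/- arXiv:2010.06289 — 2 statements merged into one kernel-verified Lean document; each statement's English description precedes it below -/
import Mathlib

section
/- Let Ω ⊂ ℝⁿ be open and ρ ∈ C²(Ω) a positive function with Δρ ≤ 0 on Ω (ρ superharmonic). Then for every u ∈ C_0^∞(Ω): ∫_Ω (u²/ρ²) |∇ρ|² dx ≤ 4 ∫_Ω |∇u|² dx. -/
open MeasureTheory

noncomputable def lap {n : ℕ} (f : EuclideanSpace ℝ (Fin n) → ℝ)
    (x : EuclideanSpace ℝ (Fin n)) : ℝ :=
  ∑ i, fderiv ℝ (fun y => fderiv ℝ f y (EuclideanSpace.single i 1)) x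
      (EuclideanSpace.single i 1)

theorem hs_grad {n : ℕ} (f : EuclideanSpace ℝ (Fin n) → ℝ) (x : EuclideanSpace ℝ (Fin n)) :
    ‖gradient f x‖ ^ 2 = ∑ i, (fderiv ℝ f x (EuclideanSpace.single i 1)) ^ 2 := by
  rw [EuclideanSpace.norm_sq_eq]
  refine Finset.sum_congr rfl fun i _ => ?_
  have h : fderiv ℝ f x (EuclideanSpace.single i 1) = gradient f x i := by
    have h2 : inner ℝ (gradient f x) (EuclideanSpace.single i (1:ℝ))
        = fderiv ℝ f x (EuclideanSpace.single i 1) := by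
      rw [gradient, InnerProductSpace.toDual_symm_apply]
    rw [← h2, EuclideanSpace.inner_single_right]
    simp
  rw [h, Real.norm_eq_abs, sq_abs]

theorem hs_int {n : ℕ} (V : EuclideanSpace ℝ (Fin n) → ℝ) (hV : ContDiff ℝ 1 V)
    (hc : HasCompactSupport V) (e : EuclideanSpace ℝ (Fin n)) :
    Integrable (fun x => fderiv ℝ V x e) ∧ ∫ x, fderiv ℝ V x e = 0 := by
  have hcont : Continuous (fun x => fderiv ℝ V x e) :=
    (hV.continuous_fderiv one_ne_zero).clm_apply continuous_const
  have hi : Integrable (fun x => fderiv ℝ V x e) :=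
    hcont.integrable_of_hasCompactSupport (hc.fderiv_apply ℝ e)
  have hiV : Integrable V := hV.continuous.integrable_of_hasCompactSupport hc
  refine ⟨hi, ?_⟩
  have := integral_mul_fderiv_eq_neg_fderiv_mul_of_integrable
    (μ := (volume : Measure (EuclideanSpace ℝ (Fin n)))) (v := e)
    (f := fun _ => (1:ℝ)) (g := V) (by simp) (by simpa using hi) (by simpa using hiV)
    (by intro x _; fun_prop) (by intro x _; exact hV.differentiable one_ne_zero x)
  simpa using this

theorem hardy_superharmonic (n : ℕ) (Ω : Set (EuclideanSpace ℝ (Fin n)))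
    (hΩ : IsOpen Ω) (ρ : EuclideanSpace ℝ (Fin n) → ℝ)
    (hρC2 : ContDiffOn ℝ 2 ρ Ω) (hρpos : ∀ x ∈ Ω, 0 < ρ x)
    (hsuper : ∀ x ∈ Ω, lap ρ x ≤ 0)
    (u : EuclideanSpace ℝ (Fin n) → ℝ)
    (hu : ContDiff ℝ (⊤ : ℕ∞) u) (hcs : HasCompactSupport u) (hsupp : tsupport u ⊆ Ω) :
    ∫ x in Ω, (u x) ^ 2 / (ρ x) ^ 2 * ‖gradient ρ x‖ ^ 2
      ≤ 4 * ∫ x in Ω, ‖gradient u x‖ ^ 2 := by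
  have hu1 : ContDiff ℝ 1 u := hu.of_le (by exact_mod_cast le_top)
  let e : Fin n → EuclideanSpace ℝ (Fin n) := fun i => EuclideanSpace.single i 1
  let V : Fin n → EuclideanSpace ℝ (Fin n) → ℝ :=
    fun i x => (u x) ^ 2 * (fderiv ℝ ρ x (e i) * (ρ x)⁻¹)
  have hρat : ∀ x ∈ Ω, ContDiffAt ℝ 2 ρ x := fun x hx => hρC2.contDiffAt (hΩ.mem_nhds hx)
  have hdρ : ∀ i, ∀ x ∈ Ω, ContDiffAt ℝ 1 (fun y => fderiv ℝ ρ y (e i)) x := fun i x hx =>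
    ((hρat x hx).fderiv_right (m := 1) (by norm_num)).clm_apply contDiffAt_const
  have hVsupp : ∀ i x, x ∉ tsupport u → V i =ᶠ[nhds x] 0 := by
    intro i x hx
    filter_upwards [notMem_tsupport_iff_eventuallyEq.1 hx] with y hy
    simp [V, hy]
  have hVC : ∀ i, ContDiff ℝ 1 (V i) := by
    intro i
    rw [contDiff_iff_contDiffAt]
    intro x
    by_cases hx : x ∈ tsupport u
    · have hxΩ := hsupp hx
      exact (hu1.contDiffAt.pow 2).mul ((hdρ i x hxΩ).mul
        (((hρat x hxΩ).of_le (by norm_num)).inv (hρpos x hxΩ).ne'))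
    · exact contDiffAt_const.congr_of_eventuallyEq (hVsupp i x hx)
  have hVc : ∀ i, HasCompactSupport (V i) := by
    intro i
    refine hcs.mono fun x hx hux => hx ?_
    simp [V, hux]
  have hVd : ∀ i, ∀ x ∈ Ω, fderiv ℝ (V i) x (e i) =
      2 * u x * fderiv ℝ u x (e i) * (fderiv ℝ ρ x (e i) / ρ x)
      + u x ^ 2 / ρ x * fderiv ℝ (fun y => fderiv ℝ ρ y (e i)) x (e i)
      - u x ^ 2 / ρ x ^ 2 * (fderiv ℝ ρ x (e i)) ^ 2 := by
    intro i x hx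
    have h1 := (hu1.differentiable one_ne_zero x).hasFDerivAt
    have h2 := ((hdρ i x hx).differentiableAt one_ne_zero).hasFDerivAt
    have h3 := ((hρat x hx).differentiableAt two_ne_zero).hasFDerivAt
    have hp := (hρpos x hx).ne'
    have h4 := (hasDerivAt_inv hp).comp_hasFDerivAt x h3
    have h5 := (h1.pow 2).mul (h2.mul h4)
    have h6 : HasFDerivAt (V i) _ x := h5
    rw [h6.fderiv]
    simp
    field_simp
    ring
  have hGc : Continuous (fun x => ‖gradient u x‖ ^ 2) := by
    simp_rw [hs_grad]
    refine continuous_finsetSum _ fun i _ => Continuous.pow ?_ 2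
    exact (hu1.continuous_fderiv one_ne_zero).clm_apply continuous_const
  have hGs : ∀ x, x ∉ tsupport u → gradient u x = 0 := by
    intro x hx
    have : fderiv ℝ u x = 0 := by
      by_contra h
      exact hx (support_fderiv_subset ℝ h)
    simp [gradient, this]
  have hGi : Integrable (fun x => ‖gradient u x‖ ^ 2) := by
    refine hGc.integrable_of_hasCompactSupport (HasCompactSupport.intro hcs fun x hx => ?_)
    simp [hGs x hx]
  have key : ∀ x ∈ Ω, (u x) ^ 2 / (ρ x) ^ 2 * ‖gradient ρ x‖ ^ 2 ≤
      4 * ‖gradient u x‖ ^ 2 - 2 * ∑ i, fderiv ℝ (V i) x (e i) := by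
    intro x hx
    have hl := hsuper x hx
    have hp := hρpos x hx
    rw [hs_grad, hs_grad]
    have hl2 : u x ^ 2 / ρ x * lap ρ x ≤ 0 :=
      mul_nonpos_of_nonneg_of_nonpos (by positivity) hl
    have hsum : ∑ i, fderiv ℝ (V i) x (e i) =
        (∑ i, 2 * u x * fderiv ℝ u x (e i) * (fderiv ℝ ρ x (e i) / ρ x))
        + u x ^ 2 / ρ x * lap ρ x
        - u x ^ 2 / ρ x ^ 2 * ∑ i, (fderiv ℝ ρ x (e i)) ^ 2 := by
      rw [lap, Finset.mul_sum, Finset.mul_sum, ← Finset.sum_add_distrib, ← Finset.sum_sub_distrib]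
      exact Finset.sum_congr rfl fun i _ => hVd i x hx
    have hcs2 : 2 * (∑ i, 2 * u x * fderiv ℝ u x (e i) * (fderiv ℝ ρ x (e i) / ρ x)) ≤
        4 * (∑ i, (fderiv ℝ u x (e i)) ^ 2)
        + u x ^ 2 / ρ x ^ 2 * ∑ i, (fderiv ℝ ρ x (e i)) ^ 2 := by
      rw [Finset.mul_sum, Finset.mul_sum, Finset.mul_sum, ← Finset.sum_add_distrib]
      refine Finset.sum_le_sum fun i _ => ?_
      have := sq_nonneg (2 * fderiv ℝ u x (e i) - u x * (fderiv ℝ ρ x (e i) / ρ x))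
      have h7 : u x ^ 2 / ρ x ^ 2 * (fderiv ℝ ρ x (e i)) ^ 2
        = (u x * (fderiv ℝ ρ x (e i) / ρ x)) ^ 2 := by ring
      rw [h7]
      nlinarith
    rw [hsum]
    change u x ^ 2 / ρ x ^ 2 * ∑ i, (fderiv ℝ ρ x (e i)) ^ 2 ≤
      4 * (∑ i, (fderiv ℝ u x (e i)) ^ 2) - _
    linarith
  have hDi : Integrable (fun x => ∑ i, fderiv ℝ (V i) x (e i)) :=
    integrable_finset_sum _ fun i _ => (hs_int (V i) (hVC i) (hVc i) (e i)).1
  have hD0 : ∫ x in Ω, ∑ i, fderiv ℝ (V i) x (e i) = 0 := by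
    rw [setIntegral_eq_integral_of_forall_compl_eq_zero,
      integral_finset_sum _ fun i _ => (hs_int (V i) (hVC i) (hVc i) (e i)).1]
    · exact Finset.sum_eq_zero fun i _ => (hs_int (V i) (hVC i) (hVc i) (e i)).2
    · intro x hx
      refine Finset.sum_eq_zero fun i _ => ?_
      rw [(hVsupp i x fun h => hx (hsupp h)).fderiv_eq]
      simp
  calc ∫ x in Ω, (u x) ^ 2 / (ρ x) ^ 2 * ‖gradient ρ x‖ ^ 2
      ≤ ∫ x in Ω, (4 * ‖gradient u x‖ ^ 2 - 2 * ∑ i, fderiv ℝ (V i) x (e i)) := by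
        refine integral_mono_of_nonneg (Filter.Eventually.of_forall fun x => ?_) ?_ ?_
        · simp only [Pi.zero_apply]
          positivity
        · exact ((hGi.const_mul 4).sub (hDi.const_mul 2)).integrableOn
        · filter_upwards [ae_restrict_mem hΩ.measurableSet] with x hx using key x hx
    _ = 4 * ∫ x in Ω, ‖gradient u x‖ ^ 2 := by
        rw [integral_sub (hGi.const_mul 4).integrableOn (hDi.const_mul 2).integrableOn,
          integral_const_mul, integral_const_mul, hD0]
        simp
end

section
/- Let Ω ⊂ ℝⁿ be open, X a C¹ vector field, f a positive continuous function on Ω with f ≤ -div X, and let q ∈ ℝ, s > 0 and p, p' > 1 with 1/p + 1/p' = 1. Then for every u ∈ C_0^∞(Ω): ∫_Ω |u|^s |X|^q dx ≤ 4^{1/p} (∫_Ω (|X|²/f) |∇u|² dx)^{1/p} (∫_Ω (|X|^{qp'}/f^{p'-1}) |u|^{(ps-2)/(p-1)} dx)^{1/p'}. -/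
open MeasureTheory

noncomputable def divg {n : ℕ} (X : EuclideanSpace ℝ (Fin n) → EuclideanSpace ℝ (Fin n))
    (x : EuclideanSpace ℝ (Fin n)) : ℝ :=
  ∑ i, fderiv ℝ X x (EuclideanSpace.single i 1) i

theorem hardy_aux (n : ℕ) (Ω : Set (EuclideanSpace ℝ (Fin n)))
    (hΩ : IsOpen Ω)
    (X : EuclideanSpace ℝ (Fin n) → EuclideanSpace ℝ (Fin n)) (hX : ContDiff ℝ 1 X)
    (f : EuclideanSpace ℝ (Fin n) → ℝ)
    (hfc : ContinuousOn f Ω) (hfpos : ∀ x ∈ Ω, 0 < f x)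
    (hfdiv : ∀ x ∈ Ω, f x ≤ - divg X x)
    (u : EuclideanSpace ℝ (Fin n) → ℝ)
    (hu : ContDiff ℝ (⊤ : ℕ∞) u) (hcs : HasCompactSupport u) (hsupp : tsupport u ⊆ Ω)
    (hint2 : IntegrableOn (fun x => (‖X x‖ ^ 2 / f x) * ‖gradient u x‖ ^ 2) Ω) :
    IntegrableOn (fun x => f x * u x ^ 2) Ω ∧
    ∫ x in Ω, f x * u x ^ 2 ≤ 4 * ∫ x in Ω, (‖X x‖ ^ 2 / f x) * ‖gradient u x‖ ^ 2 := by
  have hu1 : ContDiff ℝ 1 u := hu.of_le (by exact_mod_cast le_top)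
  have hud : Differentiable ℝ u := hu1.differentiable (by simp)
  have hXd : Differentiable ℝ X := hX.differentiable (by simp)
  have hfuc : Continuous (fun x => f x * u x ^ 2) := by
    rw [continuous_iff_continuousAt]
    intro x
    by_cases hx : x ∈ Ω
    · exact (hfc.continuousAt (hΩ.mem_nhds hx)).mul (hu.continuous.continuousAt.pow 2)
    · have : u =ᶠ[nhds x] 0 := notMem_tsupport_iff_eventuallyEq.1 (fun h => hx (hsupp h))
      have h2 : (fun x => f x * u x ^ 2) =ᶠ[nhds x] fun _ => 0 := by
        filter_upwards [this] with y hy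
        simp [hy]
      exact continuousAt_const.congr h2.symm
  have hfui : Integrable (fun x => f x * u x ^ 2) := by
    apply hfuc.integrable_of_hasCompactSupport
    apply hcs.mono
    intro x hx h
    apply hx
    simp [h]
  refine ⟨hfui.integrableOn, ?_⟩
  have hc2 : HasCompactSupport (fun x => u x ^ 2) := by
    apply hcs.mono
    intro x hx h
    apply hx
    simp [h]
  -- derivative of the components
  have hcompd : ∀ i, Differentiable ℝ (fun x => X x i) := fun i => by fun_prop
  have hcomp : ∀ i x v, fderiv ℝ (fun x => X x i) x v = fderiv ℝ X x v i := by
    intro i x v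
    have h := ((EuclideanSpace.proj (𝕜 := ℝ) i).hasFDerivAt (x := X x)).comp x (hXd x).hasFDerivAt
    have h' : HasFDerivAt (fun x => X x i) _ x := h
    rw [h'.fderiv]
    rfl
  have hsq : ∀ x v, fderiv ℝ (fun x => u x ^ 2) x v = 2 * u x * fderiv ℝ u x v := by
    intro x v
    have h := (hud x).hasFDerivAt.pow 2
    rw [h.fderiv]
    simp
  have hdc : ∀ v, Continuous (fun x => fderiv ℝ u x v) := fun v =>
    (hu1.continuous_fderiv (by simp)).clm_apply continuous_const
  have hXdc : ∀ v, Continuous (fun x => fderiv ℝ X x v) := fun v =>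
    (hX.continuous_fderiv (by simp)).clm_apply continuous_const
  have i1 : ∀ i, Integrable (fun x => X x i * (2 * u x * fderiv ℝ u x (EuclideanSpace.single i 1))) := by
    intro i
    apply Continuous.integrable_of_hasCompactSupport
    · have := hdc (EuclideanSpace.single i 1)
      have := hu.continuous
      have := hX.continuous
      fun_prop
    · apply hcs.mono
      intro x hx h
      apply hx
      simp [h]
  have i2 : ∀ i, Integrable (fun x => fderiv ℝ X x (EuclideanSpace.single i 1) i * u x ^ 2) := by
    intro i
    apply Continuous.integrable_of_hasCompactSupport
    · have := hXdc (EuclideanSpace.single i 1)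
      have := hu.continuous
      fun_prop
    · apply hcs.mono
      intro x hx h
      apply hx
      simp [h]
  have ibp : ∀ i, ∫ x, X x i * (2 * u x * fderiv ℝ u x (EuclideanSpace.single i 1))
      = - ∫ x, fderiv ℝ X x (EuclideanSpace.single i 1) i * u x ^ 2 := by
    intro i
    have := integral_mul_fderiv_eq_neg_fderiv_mul_of_integrable (μ := volume)
      (f := fun x => X x i) (g := fun x => u x ^ 2) (v := EuclideanSpace.single i 1)
      (by simpa only [hcomp] using i2 i) (by simpa only [hsq] using i1 i)
      (by
        apply Continuous.integrable_of_hasCompactSupport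
        · have := hu.continuous
          have := hX.continuous
          fun_prop
        · apply hcs.mono
          intro x hx h
          apply hx
          simp [h]) (fun x _ => hcompd i x) (fun x _ => (hud.pow 2) x)
    simpa only [hcomp, hsq] using this
  have hsum : ∀ x, ∑ i, X x i * (2 * u x * fderiv ℝ u x (EuclideanSpace.single i 1))
      = 2 * u x * fderiv ℝ u x (X x) := by
    intro x
    have h : X x = ∑ i, X x i • EuclideanSpace.single i (1:ℝ) := by
      ext j
      simp [Finset.sum_apply, Pi.single_apply]
    conv_rhs => rw [h]
    rw [map_sum, Finset.mul_sum]
    refine Finset.sum_congr rfl fun i _ => ?_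
    rw [map_smul, smul_eq_mul]
    ring
  have hI1 : Integrable (fun x => 2 * u x * fderiv ℝ u x (X x)) := by
    have := integrable_finsetSum Finset.univ (fun i _ => i1 i)
    simpa only [hsum] using this
  have hI2 : Integrable (fun x => -divg X x * u x ^ 2) := by
    have := (integrable_finsetSum Finset.univ (fun i _ => i2 i)).neg
    refine this.congr (Filter.Eventually.of_forall fun x => ?_)
    simp [divg, Finset.sum_mul]
  have key : ∫ x, -divg X x * u x ^ 2 = ∫ x, 2 * u x * fderiv ℝ u x (X x) := by
    simp only [← hsum]
    rw [integral_finsetSum _ (fun i _ => i1 i)]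
    simp only [ibp]
    rw [Finset.sum_neg_distrib, ← integral_finsetSum _ (fun i _ => i2 i), ← integral_neg]
    simp [divg, Finset.sum_mul]
  have hu0 : ∀ x, x ∉ Ω → u x = 0 := fun x hx => image_eq_zero_of_notMem_tsupport fun h => hx (hsupp h)
  have e1 : ∫ x in Ω, f x * u x ^ 2 ≤ ∫ x in Ω, 2 * u x * fderiv ℝ u x (X x) := by
    calc _ ≤ ∫ x in Ω, -divg X x * u x ^ 2 := by
          apply setIntegral_mono_on hfui.integrableOn hI2.integrableOn hΩ.measurableSet
          intro x hx
          exact mul_le_mul_of_nonneg_right (hfdiv x hx) (sq_nonneg _)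
      _ = _ := by
          rw [setIntegral_eq_integral_of_forall_compl_eq_zero, key,
            setIntegral_eq_integral_of_forall_compl_eq_zero]
          · intro x hx; simp [hu0 x hx]
          · intro x hx; simp [hu0 x hx]
  have e2 : ∫ x in Ω, 2 * u x * fderiv ℝ u x (X x) ≤
      ∫ x in Ω, ((1/2) * (f x * u x ^ 2) + 2 * ((‖X x‖ ^ 2 / f x) * ‖gradient u x‖ ^ 2)) := by
    apply setIntegral_mono_on hI1.integrableOn
      ((hfui.integrableOn.const_mul _).add (hint2.const_mul _)) hΩ.measurableSet
    intro x hx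
    have hg : ‖gradient u x‖ = ‖fderiv ℝ u x‖ := by
      unfold gradient; exact LinearIsometryEquiv.norm_map _ _
    have hb : |fderiv ℝ u x (X x)| ≤ ‖gradient u x‖ * ‖X x‖ := by
      rw [hg]; exact (fderiv ℝ u x).le_opNorm _
    have hf := hfpos x hx
    have hD : (fderiv ℝ u x (X x)) ^ 2 ≤ (‖gradient u x‖ * ‖X x‖) ^ 2 := sq_le_sq' (by linarith [(abs_le.1 hb).1]) (abs_le.1 hb).2
    have : 2 * u x * fderiv ℝ u x (X x) ≤ (1/2) * (f x * u x ^ 2) + 2 * ((fderiv ℝ u x (X x)) ^ 2 / f x) := by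
      have h0 : 0 ≤ (f x * u x - 2 * fderiv ℝ u x (X x)) ^ 2 / (2 * f x) := by positivity
      have : (f x * u x - 2 * fderiv ℝ u x (X x)) ^ 2 / (2 * f x) = (1/2) * (f x * u x ^ 2) + 2 * ((fderiv ℝ u x (X x)) ^ 2 / f x) - 2 * u x * fderiv ℝ u x (X x) := by
        field_simp
        ring
      linarith
    have h3 : (fderiv ℝ u x (X x)) ^ 2 / f x ≤ (‖X x‖ ^ 2 / f x) * ‖gradient u x‖ ^ 2 := by
      rw [div_mul_eq_mul_div]
      apply div_le_div_of_nonneg_right _ hf.le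
      linarith
    show _ ≤ (1/2) * (f x * u x ^ 2) + 2 * ((‖X x‖ ^ 2 / f x) * ‖gradient u x‖ ^ 2)
    linarith
  rw [integral_add (hfui.integrableOn.const_mul _) (hint2.const_mul _), integral_const_mul, integral_const_mul] at e2
  linarith

theorem general_interpolation (n : ℕ) (Ω : Set (EuclideanSpace ℝ (Fin n)))
    (hΩ : IsOpen Ω)
    (X : EuclideanSpace ℝ (Fin n) → EuclideanSpace ℝ (Fin n)) (hX : ContDiff ℝ 1 X)
    (f : EuclideanSpace ℝ (Fin n) → ℝ)
    (hfc : ContinuousOn f Ω) (hfpos : ∀ x ∈ Ω, 0 < f x)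
    (hfdiv : ∀ x ∈ Ω, f x ≤ - divg X x)
    (q s p p' : ℝ) (hs : 0 < s) (hp : 1 < p) (hp' : 1 < p')
    (hconj : 1 / p + 1 / p' = 1)
    (u : EuclideanSpace ℝ (Fin n) → ℝ)
    (hu : ContDiff ℝ (⊤ : ℕ∞) u) (hcs : HasCompactSupport u) (hsupp : tsupport u ⊆ Ω)
    (hint1 : IntegrableOn (fun x => |u x| ^ s * ‖X x‖ ^ q) Ω)
    (hint2 : IntegrableOn (fun x => (‖X x‖ ^ 2 / f x) * ‖gradient u x‖ ^ 2) Ω)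
    (hint3 : IntegrableOn
      (fun x => (‖X x‖ ^ (q * p') / f x ^ (p' - 1)) * |u x| ^ ((p * s - 2) / (p - 1))) Ω) :
    ∫ x in Ω, |u x| ^ s * ‖X x‖ ^ q
      ≤ (4 : ℝ) ^ (1 / p) *
          (∫ x in Ω, (‖X x‖ ^ 2 / f x) * ‖gradient u x‖ ^ 2) ^ (1 / p) *
          (∫ x in Ω, (‖X x‖ ^ (q * p') / f x ^ (p' - 1)) *
              |u x| ^ ((p * s - 2) / (p - 1))) ^ (1 / p') := by
  obtain ⟨hfi, hardy⟩ := hardy_aux n Ω hΩ X hX f hfc hfpos hfdiv u hu hcs hsupp hint2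
  have hp0 : 0 < p := by linarith
  have hp'0 : 0 < p' := by linarith
  have hpq : p.HolderConjugate p' := by
    rw [Real.holderConjugate_iff]
    exact ⟨hp, by simpa using hconj⟩
  set H := fun x => (‖X x‖ ^ (q * p') / f x ^ (p' - 1)) * |u x| ^ ((p * s - 2) / (p - 1)) with hH
  have hHnn : ∀ x ∈ Ω, 0 ≤ H x := fun x hx => by
    have := hfpos x hx
    simp only [hH]
    positivity
  have hFnn : ∀ x ∈ Ω, 0 ≤ f x * u x ^ 2 := fun x hx => by
    have := hfpos x hx
    positivity
  have memaux : ∀ (h : EuclideanSpace ℝ (Fin n) → ℝ) (r : ℝ), 0 < r → IntegrableOn h Ω →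
      (∀ x ∈ Ω, 0 ≤ h x) →
      MemLp (fun x => h x ^ (1 / r)) (ENNReal.ofReal r) (volume.restrict Ω) := by
    intro h r hr hi hnn
    have hm : AEStronglyMeasurable (fun x => h x ^ (1 / r)) (volume.restrict Ω) :=
      (hi.aestronglyMeasurable.aemeasurable.pow_const _).aestronglyMeasurable
    rw [← integrable_norm_rpow_iff hm (by simpa using hr) (by simp)]
    refine hi.congr ?_
    filter_upwards [ae_restrict_mem hΩ.measurableSet] with x hx
    have := hnn x hx
    rw [ENNReal.toReal_ofReal hr.le, Real.norm_of_nonneg (by positivity), ← Real.rpow_mul this,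
      one_div_mul_cancel hr.ne', Real.rpow_one]
  have hF := memaux _ p hp0 hfi hFnn
  have hG := memaux _ p' hp'0 hint3 hHnn
  have holder := integral_mul_le_Lp_mul_Lq_of_nonneg hpq
    (by filter_upwards [ae_restrict_mem hΩ.measurableSet] with x hx
        have := hFnn x hx
        show 0 ≤ (f x * u x ^ 2) ^ (1 / p)
        positivity)
    (by filter_upwards [ae_restrict_mem hΩ.measurableSet] with x hx
        have := hHnn x hx
        show 0 ≤ (H x) ^ (1 / p')
        positivity) hF hG
  have c1 : ∫ x in Ω, ((f x * u x ^ 2) ^ (1 / p)) ^ p = ∫ x in Ω, f x * u x ^ 2 := by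
    apply setIntegral_congr_fun hΩ.measurableSet
    intro x hx
    show ((f x * u x ^ 2) ^ (1 / p)) ^ p = _
    rw [← Real.rpow_mul (hFnn x hx), one_div_mul_cancel hp0.ne', Real.rpow_one]
  have c2 : ∫ x in Ω, (H x ^ (1 / p')) ^ p' = ∫ x in Ω, H x := by
    apply setIntegral_congr_fun hΩ.measurableSet
    intro x hx
    show (H x ^ (1 / p')) ^ p' = _
    rw [← Real.rpow_mul (hHnn x hx), one_div_mul_cancel hp'0.ne', Real.rpow_one]
  have c3 : ∫ x in Ω, |u x| ^ s * ‖X x‖ ^ q ≤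
      ∫ x in Ω, (f x * u x ^ 2) ^ (1 / p) * H x ^ (1 / p') := by
    have := hpq.ennrealOfReal
    apply setIntegral_mono_on hint1 (MemLp.integrable_mul hF hG) hΩ.measurableSet
    intro x hx
    have hf := hfpos x hx
    by_cases hux : u x = 0
    · have := hHnn x hx
      have := hFnn x hx
      have hz : |u x| ^ s * ‖X x‖ ^ q = 0 := by
        rw [hux, abs_zero, Real.zero_rpow hs.ne', zero_mul]
      rw [hz]
      exact mul_nonneg (Real.rpow_nonneg (hFnn x hx) _) (Real.rpow_nonneg (hHnn x hx) _)
    · have ha : 0 < |u x| := abs_pos.2 hux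
      apply le_of_eq
      simp only [hH, Pi.mul_apply]
      have hp1 : p - 1 ≠ 0 := by linarith
      have hpe : p' = p / (p - 1) := hpq.conjugate_eq
      have hsq : u x ^ 2 = |u x| ^ (2:ℝ) := by
        rw [← sq_abs]; norm_cast
      rw [Real.mul_rpow hf.le (sq_nonneg _), Real.mul_rpow (by positivity) (by positivity),
        Real.div_rpow (by positivity) (by positivity), ← Real.rpow_mul (norm_nonneg _),
        ← Real.rpow_mul hf.le, ← Real.rpow_mul ha.le, hsq, ← Real.rpow_mul ha.le]
      have t1 : q * p' * (1 / p') = q := by field_simp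
      have t2 : (p' - 1) * (1 / p') = 1 / p := by
        rw [sub_mul, mul_one_div_cancel hp'0.ne']; linarith
      have t3 : s = 2 * (1 / p) + (p * s - 2) / (p - 1) * (1 / p') := by
        rw [hpe]; field_simp; ring
      rw [t1, t2]
      conv_lhs => rw [t3]
      rw [Real.rpow_add ha]
      have : 0 < f x ^ (1 / p) := by positivity
      field_simp
  rw [c1, c2] at holder
  refine c3.trans (holder.trans ?_)
  have hA : 0 ≤ ∫ x in Ω, f x * u x ^ 2 := setIntegral_nonneg hΩ.measurableSet hFnn
  have hC : 0 ≤ ∫ x in Ω, H x := setIntegral_nonneg hΩ.measurableSet hHnn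
  have hB : 0 ≤ ∫ x in Ω, (‖X x‖ ^ 2 / f x) * ‖gradient u x‖ ^ 2 :=
    setIntegral_nonneg hΩ.measurableSet fun x hx => by
      have := hfpos x hx
      positivity
  rw [← Real.mul_rpow (by norm_num) hB]
  gcongr
end
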